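/- arXiv:1403.0476 — 2 statements merged into one kernel-verified Lean document; each statement's English description precedes it below -/
import Mathlib

section
/- Let D be a finite nonempty set and let 𝒞 be a weighted clone over a clone C of operations on D. Then the positive clone C⁺, defined as the set of all projections on D together with all operations lying in supp(ω) for some weighting ω ∈ 𝒞, is itself a clone: it contains all projections and is closed under superposition of operations. -/
/-! Basic framework for Valued Constraint Satisfaction Problems (VCSP):
operations, clones, weightings, weighted clones, cost functions,
(weighted/fractional) polymorphisms, expressibility and weighted relational clones. -/

/-- A `k`-ary operation on `D`. -/
abbrev Op (D : Type) (k : ℕ) : Type := (Fin k → D) → D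

/-- The `i`-th `k`-ary projection on `D`. -/
def proj (D : Type) {k : ℕ} (i : Fin k) : Op D k := fun x => x i

/-- An operation is a projection. -/
def IsProj {D : Type} {k : ℕ} (f : Op D k) : Prop := ∃ i : Fin k, f = proj D i

/-- Superposition `f[g₁,…,g_k]` of a `k`-ary operation with `k` many `l`-ary operations. -/
def superposeOp {D : Type} {k l : ℕ} (f : Op D k) (g : Fin k → Op D l) : Op D l :=
  fun x => f fun i => g i x

/-- A clone of operations on `D`: contains all projections and is closed under superposition. -/
structure IsClone {D : Type} (C : ∀ k, Set (Op D k)) : Prop where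
  proj_mem : ∀ (k : ℕ) (i : Fin k), proj D i ∈ C k
  superpose_mem : ∀ (k l : ℕ) (f : Op D k) (g : Fin k → Op D l),
    f ∈ C k → (∀ i, g i ∈ C l) → superposeOp f g ∈ C l

/-- A `k`-ary weighting of the clone `C`: a rational-valued function on `k`-ary operations,
vanishing outside `C`, summing to `0`, and negative only on projections. -/
structure IsWeighting {D : Type} [Fintype D] [DecidableEq D] (C : ∀ k, Set (Op D k))
    {k : ℕ} (ω : Op D k → ℚ) : Prop where
  support_mem : ∀ f : Op D k, ω f ≠ 0 → f ∈ C k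
  sum_zero : ∑ f : Op D k, ω f = 0
  neg_imp_proj : ∀ f : Op D k, ω f < 0 → IsProj f

/-- Superposition of a `k`-ary weighting with `k` many `l`-ary operations. -/
def wSuperpose {D : Type} [Fintype D] [DecidableEq D] {k l : ℕ}
    (ω : Op D k → ℚ) (g : Fin k → Op D l) : Op D l → ℚ :=
  fun f' => ∑ f ∈ Finset.univ.filter (fun f : Op D k => superposeOp f g = f'), ω f

/-- A weighted clone over the clone `C`: a nonempty family of weightings of `C` closed under
non-negative scaling, addition of weightings of equal arity and proper superposition. -/
structure IsWeightedClone {D : Type} [Fintype D] [DecidableEq D]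
    (C : ∀ k, Set (Op D k)) (W : ∀ k, Set (Op D k → ℚ)) : Prop where
  clone : IsClone C
  weighting : ∀ (k : ℕ), ∀ ω ∈ W k, IsWeighting C ω
  nonempty : ∃ k, (W k).Nonempty
  scale_mem : ∀ (k : ℕ) (c : ℚ), 0 ≤ c → ∀ ω ∈ W k, (fun f => c * ω f) ∈ W k
  add_mem : ∀ (k : ℕ), ∀ ω₁ ∈ W k, ∀ ω₂ ∈ W k, (fun f => ω₁ f + ω₂ f) ∈ W k
  superpose_mem : ∀ (k l : ℕ), ∀ ω ∈ W k, ∀ g : Fin k → Op D l,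
    (∀ i, g i ∈ C l) → IsWeighting C (wSuperpose ω g) → wSuperpose ω g ∈ W l

/-- The positive clone of a family of weightings: all projections together with all operations
receiving positive weight from some weighting in the family. -/
def posClone {D : Type} [Fintype D] [DecidableEq D] (W : ∀ k, Set (Op D k → ℚ)) :
    ∀ k, Set (Op D k) :=
  fun k => {f | IsProj f ∨ ∃ ω ∈ W k, 0 < ω f}

/-- An `r`-ary cost function on `D`, with values in `ℚ ∪ {∞}`. -/
abbrev CostF (D : Type) (r : ℕ) : Type := (Fin r → D) → WithTop ℚ

/-- The feasibility relation of a cost function. -/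
def Feas {D : Type} {r : ℕ} (ϱ : CostF D r) : Set (Fin r → D) := {x | ϱ x ≠ ⊤}

/-- Coordinate-wise application of a `k`-ary operation to `k` many `r`-tuples. -/
def appRows {D : Type} {k r : ℕ} (f : Op D k) (xs : Fin k → Fin r → D) : Fin r → D :=
  fun j => f fun i => xs i j

/-- `f` is a polymorphism of `ϱ`: `Feas ϱ` is closed under coordinate-wise application of `f`. -/
def IsPolymorphism {D : Type} {k r : ℕ} (f : Op D k) (ϱ : CostF D r) : Prop :=
  ∀ xs : Fin k → Fin r → D, (∀ i, xs i ∈ Feas ϱ) → appRows f xs ∈ Feas ϱ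

/-- A valued constraint language on `D`: a set of cost functions of various arities. -/
abbrev VLang (D : Type) : Type := Set (Σ r : ℕ, CostF D r)

/-- The clone of polymorphisms of a language. -/
def Pol {D : Type} (Γ : VLang D) : ∀ k, Set (Op D k) :=
  fun _ => {f | ∀ ϱ ∈ Γ, IsPolymorphism f ϱ.2}

/-- Multiplication of an element of `ℚ ∪ {∞}` by a rational scalar (`c·∞ = ∞`). -/
def qmul (c : ℚ) (x : WithTop ℚ) : WithTop ℚ := WithTop.map (fun q => c * q) x

/-- The sum `∑_f ω(f)·ϱ(f(x₁,…,x_k))`, over operations with non-zero weight. -/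
def wSum {D : Type} [Fintype D] [DecidableEq D] {k r : ℕ}
    (ω : Op D k → ℚ) (ϱ : CostF D r) (xs : Fin k → Fin r → D) : WithTop ℚ :=
  ∑ f ∈ Finset.univ.filter (fun f : Op D k => ω f ≠ 0), qmul (ω f) (ϱ (appRows f xs))

/-- `ω` is a weighted polymorphism of the language `Γ`. -/
def IsWeightedPolymorphism {D : Type} [Fintype D] [DecidableEq D] (Γ : VLang D)
    {k : ℕ} (ω : Op D k → ℚ) : Prop :=
  IsWeighting (Pol Γ) ω ∧
    ∀ ϱ ∈ Γ, ∀ xs : Fin k → Fin ϱ.1 → D, (∀ i, xs i ∈ Feas ϱ.2) → wSum ω ϱ.2 xs ≤ 0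

/-- The weighted polymorphisms of a language. -/
def wPol {D : Type} [Fintype D] [DecidableEq D] (Γ : VLang D) :
    ∀ k, Set (Op D k → ℚ) :=
  fun _ => {ω | IsWeightedPolymorphism Γ ω}

/-- The positive clone `Pol⁺(Γ)` of a language. -/
def PolPlus {D : Type} [Fintype D] [DecidableEq D] (Γ : VLang D) : ∀ k, Set (Op D k) :=
  posClone (wPol Γ)

/-- The map `D → D` induced by a unary operation. -/
def unaryFun {D : Type} (f : Op D 1) : D → D := fun x => f fun _ => x

/-- A language is a core if every unary operation in its positive clone is bijective. -/
def IsCore {D : Type} [Fintype D] [DecidableEq D] (Γ : VLang D) : Prop :=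
  ∀ f ∈ PolPlus Γ 1, Function.Bijective (unaryFun f)

/-- An idempotent operation. -/
def Idem {D : Type} {k : ℕ} (f : Op D k) : Prop := ∀ x : D, (f fun _ => x) = x

/-- A cyclic operation: `f(x₁,…,x_k) = f(x₂,…,x_k,x₁)`. -/
def CyclicOp {D : Type} {k : ℕ} (f : Op D k) : Prop :=
  ∀ x : Fin k → D, f x = f (x ∘ ⇑(finRotate k))

/-- A conservative operation. -/
def Conservative {D : Type} {k : ℕ} (f : Op D k) : Prop :=
  ∀ x : Fin k → D, ∃ i, f x = x i

/-- A Taylor operation. -/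
def IsTaylor {D : Type} {k : ℕ} (t : Op D k) : Prop :=
  Idem t ∧ ∀ j : Fin k, ∃ a b : Fin k → Fin 2, a j = 0 ∧ b j = 1 ∧
    ∀ u : Fin 2 → D, (t fun i => u (a i)) = t fun i => u (b i)

/-- An instance of `VCSP(Γ)` with variable set `V`: a finite multiset of constraints,
each a tuple of variables together with a cost function from `Γ`. -/
structure VInstance (D : Type) (Γ : VLang D) (V : Type) where
  cons : Multiset (Σ r : ℕ, (Fin r → V) × CostF D r)
  mem_lang : ∀ c ∈ cons, (⟨c.1, c.2.2⟩ : Σ r : ℕ, CostF D r) ∈ Γ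

/-- The cost of an assignment for a VCSP instance. -/
def VInstance.cost {D V : Type} {Γ : VLang D} (I : VInstance D Γ V) (s : V → D) :
    WithTop ℚ :=
  (I.cons.map fun c => c.2.2 fun i => s (c.2.1 i)).sum

/-- A cost function is expressible over a language `Δ`. -/
def Expressible {D : Type} [Fintype D] [DecidableEq D] (Δ : VLang D) {r : ℕ}
    (ϱ : CostF D r) : Prop :=
  ∃ (n : ℕ) (I : VInstance D Δ (Fin n)) (v : Fin r → Fin n),
    ∀ x : Fin r → D,
      ϱ x = (Finset.univ.filter fun s : Fin n → D => ∀ i, s (v i) = x i).inf fun s => I.cost s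

/-- A language is closed under expressibility, non-negative scaling and
addition of rational constants. -/
def IsWClosed {D : Type} [Fintype D] [DecidableEq D] (Δ : VLang D) : Prop :=
  (∀ (r : ℕ) (ϱ : CostF D r), Expressible Δ ϱ → (⟨r, ϱ⟩ : Σ r : ℕ, CostF D r) ∈ Δ) ∧
  (∀ (r : ℕ) (ϱ : CostF D r) (c : ℚ), 0 ≤ c → (⟨r, ϱ⟩ : Σ r : ℕ, CostF D r) ∈ Δ →
    (⟨r, fun x => qmul c (ϱ x)⟩ : Σ r : ℕ, CostF D r) ∈ Δ) ∧
  (∀ (r : ℕ) (ϱ : CostF D r) (c : ℚ), (⟨r, ϱ⟩ : Σ r : ℕ, CostF D r) ∈ Δ →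
    (⟨r, fun x => ϱ x + (c : WithTop ℚ)⟩ : Σ r : ℕ, CostF D r) ∈ Δ)

/-- The weighted relational clone generated by `Γ`: the smallest language containing `Γ`
closed under expressibility, non-negative scaling and addition of rational constants. -/
def wRelClo {D : Type} [Fintype D] [DecidableEq D] (Γ : VLang D) : VLang D :=
  ⋂₀ {Δ : VLang D | Γ ⊆ Δ ∧ IsWClosed Δ}

/-- The weighting `(1/k)(∑_i 1_{f_i} − ∑_i 1_{π_i})` associated with a `k`-tuple of
`k`-ary operations (a multimorphism), weights added with multiplicity. -/
def multimorphismW {D : Type} [Fintype D] [DecidableEq D] {k : ℕ} (F : Fin k → Op D k) :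
    Op D k → ℚ :=
  fun g => (1 / (k : ℚ)) *
    (((Finset.univ.filter fun i : Fin k => F i = g).card : ℚ) -
     ((Finset.univ.filter fun i : Fin k => proj D i = g).card : ℚ))

/-- `Γ` admits the multimorphism `⟨F 0, …, F (k-1)⟩`. -/
def AdmitsMultimorphism {D : Type} [Fintype D] [DecidableEq D] {k : ℕ}
    (Γ : VLang D) (F : Fin k → Op D k) : Prop :=
  multimorphismW F ∈ wPol Γ k

/-- An `m`-ary fractional operation: a probability distribution on `m`-ary operations. -/
def IsFracOp {D : Type} [Fintype D] [DecidableEq D] {m : ℕ} (ω : Op D m → ℝ) : Prop :=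
  (∀ f, 0 ≤ ω f) ∧ ∑ f : Op D m, ω f = 1

/-- Multiplication of an element of `ℚ ∪ {∞}` by a real scalar, landing in `ℝ ∪ {∞}`. -/
def rmul (c : ℝ) (x : WithTop ℚ) : WithTop ℝ := WithTop.map (fun q : ℚ => c * (q : ℝ)) x

/-- `ω` is a fractional polymorphism of the language `Γ`. -/
def IsFracPolymorphism {D : Type} [Fintype D] [DecidableEq D] (Γ : VLang D) {m : ℕ}
    (ω : Op D m → ℝ) : Prop :=
  IsFracOp ω ∧ ∀ ϱ ∈ Γ, ∀ xs : Fin m → Fin ϱ.1 → D, (∀ i, xs i ∈ Feas ϱ.2) →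
    (∑ g ∈ Finset.univ.filter fun g : Op D m => 0 < ω g, rmul (ω g) (ϱ.2 (appRows g xs)))
      ≤ rmul (1 / (m : ℝ)) (∑ i : Fin m, ϱ.2 (xs i))

/-- The positive clone `fPol⁺(Γ)` defined via fractional polymorphisms. -/
def fPolPlus {D : Type} [Fintype D] [DecidableEq D] (Γ : VLang D) : ∀ k, Set (Op D k) :=
  fun k => {f | IsProj f ∨ ∃ ω : Op D k → ℝ, IsFracPolymorphism Γ ω ∧ 0 < ω f}

/-- Application of a binary operation to two elements. -/
def ap2 {D : Type} (f : Op D 2) (a b : D) : D := f ![a, b]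

/-- Application of a ternary operation to three elements. -/
def ap3 {D : Type} (f : Op D 3) (a b c : D) : D := f ![a, b, c]

/-- A ternary operation restricts to a majority operation on a subset `S`. -/
def IsMajorityOn {D : Type} (f : Op D 3) (S : Set D) : Prop :=
  ∀ x ∈ S, ∀ y ∈ S, ap3 f x x y = x ∧ ap3 f x y x = x ∧ ap3 f y x x = x

/-- A ternary operation restricts to a minority operation on a subset `S`. -/
def IsMinorityOn {D : Type} (f : Op D 3) (S : Set D) : Prop :=
  ∀ x ∈ S, ∀ y ∈ S, ap3 f x x y = y ∧ ap3 f x y x = y ∧ ap3 f y x x = y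

/-- The language `Γ_c`: `Γ` together with all unary cost functions `N_a`
(`N_a(a) = 0`, `N_a(x) = ∞` for `x ≠ a`). -/
def withConstants {D : Type} [DecidableEq D] (Γ : VLang D) : VLang D :=
  Γ ∪ {p : Σ r : ℕ, CostF D r |
        ∃ a : D, p = ⟨1, fun x => if x 0 = a then (0 : WithTop ℚ) else ⊤⟩}

/-- A language is conservative if it contains every `{0,1}`-valued unary cost function. -/
def ConservativeLang {D : Type} (Γ : VLang D) : Prop :=
  ∀ ϱ : CostF D 1, (∀ x, ϱ x = 0 ∨ ϱ x = 1) → (⟨1, ϱ⟩ : Σ r : ℕ, CostF D r) ∈ Γ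

/-- The coordinate-wise action of a `k`-ary operation on `A` on the power `A^n`. -/
def opPow {A : Type} (n : ℕ) {k : ℕ} (f : Op A k) : Op (Fin n → A) k :=
  fun xs c => f fun i => xs i c

/-- Regrouping an `(n·r)`-tuple over `A` into an `r`-tuple of elements of `A^n`. -/
def regroup (A : Type) (n r : ℕ) (y : Fin (n * r) → A) : Fin r → Fin n → A :=
  fun j c => y (finProdFinEquiv (c, j))

section WeightedClone

variable {D : Type} {k l m : ℕ}

theorem superposeOp_proj (g : Fin k → Op D l) (i : Fin k) :
    superposeOp (proj D i) g = g i := rfl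

theorem superposeOp_assoc (f : Op D k) (g : Fin k → Op D l) (h : Fin l → Op D m) :
    superposeOp (superposeOp f g) h = superposeOp f (fun i => superposeOp (g i) h) := rfl

variable [Fintype D] [DecidableEq D]

theorem wSuperpose_add (ω τ : Op D k → ℚ) (g : Fin k → Op D l) :
    wSuperpose (fun f => ω f + τ f) g = fun f => wSuperpose ω g f + wSuperpose τ g f := by
  funext f
  simp [wSuperpose, Finset.sum_add_distrib]

theorem wSuperpose_id (ω : Op D k → ℚ) : wSuperpose ω (proj D) = ω := by
  funext f
  have : (Finset.univ.filter fun f' : Op D k => superposeOp f' (proj D) = f) = {f} := by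
    ext f'
    simp only [Finset.mem_filter, Finset.mem_univ, true_and, Finset.mem_singleton]
    rfl
  simp only [wSuperpose, this, Finset.sum_singleton]

theorem wSuperpose_wSuperpose (ω : Op D k → ℚ) (g : Fin k → Op D l) (h : Fin l → Op D m) :
    wSuperpose (wSuperpose ω g) h = wSuperpose ω (fun i => superposeOp (g i) h) := by
  funext f
  simp only [wSuperpose]
  rw [← Finset.sum_fiberwise_of_maps_to
    (s := Finset.univ.filter fun f' => superposeOp f' (fun i => superposeOp (g i) h) = f)
    (g := fun f' => superposeOp f' g)
    (t := Finset.univ.filter fun f' => superposeOp f' h = f)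
    fun f' hf' => Finset.mem_filter.2 ⟨Finset.mem_univ _, (Finset.mem_filter.1 hf').2⟩]
  refine Finset.sum_congr rfl fun f' hf' => Finset.sum_congr ?_ fun _ _ => rfl
  ext f''
  simp only [Finset.mem_filter, Finset.mem_univ, true_and] at hf' ⊢
  exact ⟨fun hf'' => ⟨by rw [← superposeOp_assoc, hf'', hf'], hf''⟩, And.right⟩

theorem sum_wSuperpose (ω : Op D k → ℚ) (g : Fin k → Op D l) :
    ∑ f, wSuperpose ω g f = ∑ f, ω f :=
  Finset.sum_fiberwise _ _ _

theorem exists_of_wSuperpose_ne_zero {ω : Op D k → ℚ} {g : Fin k → Op D l} {f : Op D l}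
    (hf : wSuperpose ω g f ≠ 0) : ∃ f', ω f' ≠ 0 ∧ superposeOp f' g = f := by
  obtain ⟨f', hf', hne⟩ := Finset.exists_ne_zero_of_sum_ne_zero hf
  exact ⟨f', hne, (Finset.mem_filter.1 hf').2⟩

theorem exists_of_wSuperpose_neg {ω : Op D k → ℚ} {g : Fin k → Op D l} {f : Op D l}
    (hf : wSuperpose ω g f < 0) : ∃ f', ω f' < 0 ∧ superposeOp f' g = f := by
  by_contra! hcon
  refine absurd hf (not_lt.2 (Finset.sum_nonneg fun f' hf' => ?_))
  by_contra! hneg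
  have hsup := (Finset.mem_filter.1 hf').2
  exact hcon _ hneg hsup

/-- A superposition of a weighting is negative only on the inner operations. -/
theorem IsWeighting.eq_of_wSuperpose_neg {C : ∀ k, Set (Op D k)} {ω : Op D k → ℚ}
    (hω : IsWeighting C ω) {g : Fin k → Op D l} {f : Op D l} (hf : wSuperpose ω g f < 0) :
    ∃ i, g i = f := by
  obtain ⟨f', hneg, rfl⟩ := exists_of_wSuperpose_neg hf
  obtain ⟨i, rfl⟩ := hω.neg_imp_proj f' hneg
  exact ⟨i, rfl⟩

/-- A superposition is positive at `f[g]` if `f` has positive weight and `f[g]` is none of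
the inner operations. -/
theorem IsWeighting.wSuperpose_pos {C : ∀ k, Set (Op D k)} {ω : Op D k → ℚ}
    (hω : IsWeighting C ω) {g : Fin k → Op D l} {f : Op D k} (hf : 0 < ω f)
    (hg : ∀ i, g i ≠ superposeOp f g) : 0 < wSuperpose ω g (superposeOp f g) := by
  refine Finset.sum_pos' (fun f' hf' => ?_) ⟨f, by simp, hf⟩
  by_contra! hneg
  obtain ⟨i, rfl⟩ := hω.neg_imp_proj f' hneg
  exact hg i (Finset.mem_filter.1 hf').2

theorem wSuperpose_abs_le (ω : Op D k → ℚ) (g : Fin k → Op D l) (f : Op D l) :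
    |wSuperpose ω g f| ≤ ∑ f', |ω f'| :=
  (Finset.abs_sum_le_sum_abs _ _).trans
    (Finset.sum_le_sum_of_subset_of_nonneg (Finset.filter_subset _ _)
      fun _ _ _ => abs_nonneg _)

theorem IsWeighting.wSuperpose {C : ∀ k, Set (Op D k)} (hC : IsClone C) {ω : Op D k → ℚ}
    (hω : IsWeighting C ω) {g : Fin k → Op D l} (hg : ∀ i, g i ∈ C l)
    (hneg : ∀ f, wSuperpose ω g f < 0 → IsProj f) : IsWeighting C (wSuperpose ω g) where
  support_mem f hf := by
    obtain ⟨f', hf', rfl⟩ := exists_of_wSuperpose_ne_zero hf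
    exact hC.superpose_mem k l f' g (hω.support_mem f' hf') hg
  sum_zero := (sum_wSuperpose ω g).trans hω.sum_zero
  neg_imp_proj := hneg

namespace IsWeightedClone

variable {C : ∀ k, Set (Op D k)} {W : ∀ k, Set (Op D k → ℚ)}

theorem wSuperpose_proj_mem (h : IsWeightedClone C W) {ω : Op D k → ℚ} (hω : ω ∈ W k)
    (s : Fin k → Fin l) : wSuperpose ω (fun i => proj D (s i)) ∈ W l := by
  have hs : ∀ i, proj D (s i) ∈ C l := fun i => h.clone.proj_mem l _
  refine h.superpose_mem k l ω hω _ hs ((h.weighting k ω hω).wSuperpose h.clone hs ?_)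
  intro f hf
  obtain ⟨i, rfl⟩ := (h.weighting k ω hω).eq_of_wSuperpose_neg hf
  exact ⟨s i, rfl⟩

/-- A sum of two possibly improper superpositions lies in the weighted clone as soon as it
is nonnegative outside the projections. -/
theorem wSuperpose_add_wSuperpose_mem (h : IsWeightedClone C W) {ω : Op D k → ℚ}
    {τ : Op D m → ℚ} (hω : ω ∈ W k) (hτ : τ ∈ W m) {g : Fin k → Op D l} {g' : Fin m → Op D l}
    (hg : ∀ i, g i ∈ C l) (hg' : ∀ i, g' i ∈ C l)
    (hneg : ∀ f, wSuperpose ω g f + wSuperpose τ g' f < 0 → IsProj f) :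
    (fun f => wSuperpose ω g f + wSuperpose τ g' f) ∈ W l := by
  have hσ := h.add_mem (k + m) _ (h.wSuperpose_proj_mem hω (Fin.castAdd m))
    _ (h.wSuperpose_proj_mem hτ (Fin.natAdd k))
  have happ : ∀ i, Fin.append g g' i ∈ C l := by
    intro i
    induction i using Fin.addCases with
    | left i => simpa using hg i
    | right i => simpa using hg' i
  have key := wSuperpose_add (wSuperpose ω fun i => proj D (Fin.castAdd m i))
    (wSuperpose τ fun i => proj D (Fin.natAdd k i)) (Fin.append g g')
  simp only [wSuperpose_wSuperpose, superposeOp_proj, Fin.append_left, Fin.append_right] at key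
  have hw := (h.weighting _ _ hσ).wSuperpose h.clone happ (by rwa [key])
  have := h.superpose_mem _ _ _ hσ _ happ hw
  rwa [key] at this

theorem zero_mem (h : IsWeightedClone C W) {g : Fin k → Op D l} {ω : Op D k → ℚ}
    (hω : ω ∈ W k) (hg : ∀ i, g i ∈ C l) : (fun _ => 0) ∈ W l := by
  have hz := h.scale_mem k 0 le_rfl ω hω
  have key : wSuperpose (fun f => 0 * ω f) g = fun _ => 0 := by
    funext f
    simp [wSuperpose]
  have := h.superpose_mem k l _ hz g hg
    ((h.weighting k _ hz).wSuperpose h.clone hg fun f hf => by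
      rw [key] at hf
      exact absurd hf (lt_irrefl 0))
  rwa [key] at this

theorem posClone_subset (h : IsWeightedClone C W) : posClone W k ⊆ C k := by
  rintro f (⟨i, rfl⟩ | ⟨ω, hω, hf⟩)
  · exact h.clone.proj_mem k i
  · exact (h.weighting k ω hω).support_mem f hf.ne'

theorem nonneg_of_not_isProj (h : IsWeightedClone C W) {ω : Op D k → ℚ} (hω : ω ∈ W k)
    {f : Op D k} (hf : ¬ IsProj f) : 0 ≤ ω f :=
  not_lt.1 fun hneg => hf ((h.weighting k ω hω).neg_imp_proj f hneg)

/-- Finitely many non-projections in the positive clone can be given arbitrarily large weight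
simultaneously. -/
theorem exists_forall_le (h : IsWeightedClone C W) (h0 : (fun _ => 0) ∈ W l) {M : ℚ}
    (hM : 0 ≤ M) (s : Finset (Op D l)) (hs : ∀ f ∈ s, f ∈ posClone W l) :
    ∃ τ ∈ W l, ∀ f ∈ s, ¬ IsProj f → M ≤ τ f := by
  induction s using Finset.induction_on with
  | empty => exact ⟨_, h0, by simp⟩
  | insert a s _ ih =>
    obtain ⟨τ, hτ, hle⟩ := ih fun f hf => hs f (Finset.mem_insert_of_mem hf)
    rcases hs a (Finset.mem_insert_self a s) with ha | ⟨ω, hω, hpos⟩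
    · refine ⟨τ, hτ, fun f hf hfp => ?_⟩
      rcases Finset.mem_insert.1 hf with rfl | hf
      · exact absurd ha hfp
      · exact hle f hf hfp
    · have hω' := h.scale_mem l (M / ω a) (div_nonneg hM hpos.le) ω hω
      refine ⟨_, h.add_mem l _ hω' τ hτ, fun f hf hfp => ?_⟩
      rcases Finset.mem_insert.1 hf with rfl | hf
      · have := h.nonneg_of_not_isProj hτ hfp
        rw [div_mul_cancel₀ _ hpos.ne']
        linarith
      · have h1 := h.nonneg_of_not_isProj hω' hfp
        have h2 := hle f hf hfp
        linarith

end IsWeightedClone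

end WeightedClone

/-- The positive clone of a weighted clone is a clone. -/
theorem posClone_isClone {D : Type} [Fintype D] [DecidableEq D] [Nonempty D]
    (C : ∀ k, Set (Op D k)) (W : ∀ k, Set (Op D k → ℚ))
    (h : IsWeightedClone C W) : IsClone (posClone W) := by
  refine ⟨fun k i => Or.inl ⟨i, rfl⟩, ?_⟩
  rintro k l f g (⟨i, rfl⟩ | ⟨ω, hω, hf⟩) hg
  · exact hg i
  by_cases hgf : ∃ i, g i = superposeOp f g
  · obtain ⟨i, hi⟩ := hgf
    exact hi ▸ hg i
  push Not at hgf
  by_cases hproj : IsProj (superposeOp f g)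
  · exact Or.inl hproj
  have hgC : ∀ i, g i ∈ C l := fun i => h.posClone_subset (hg i)
  obtain ⟨τ, hτ, hle⟩ := h.exists_forall_le (h.zero_mem hω hgC)
    (Finset.sum_nonneg fun f' _ => abs_nonneg (ω f')) (Finset.univ.image g) (by simpa using hg)
  have hpos := (h.weighting k ω hω).wSuperpose_pos hf hgf
  have hmem := h.wSuperpose_add_wSuperpose_mem hω hτ hgC (h.clone.proj_mem l) (by
    intro f' hneg
    rw [wSuperpose_id] at hneg
    by_contra hfp
    have hτ0 := h.nonneg_of_not_isProj hτ hfp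
    obtain ⟨i, rfl⟩ := (h.weighting k ω hω).eq_of_wSuperpose_neg
      (show wSuperpose ω g f' < 0 by linarith)
    have h1 := hle (g i) (by simp) hfp
    have h2 := (abs_le.1 (wSuperpose_abs_le ω g (g i))).1
    linarith)
  rw [wSuperpose_id] at hmem
  exact Or.inr ⟨_, hmem, add_pos_of_pos_of_nonneg hpos (h.nonneg_of_not_isProj hτ hproj)⟩
end

section
/- Let Γ be a finite core valued constraint language on the two-element domain D = {0,1}. Then Pol⁺(Γ) contains an idempotent cyclic operation if and only if Γ admits at least one of the following six multimorphisms: ⟨min, min⟩, ⟨max, max⟩, ⟨min, max⟩, ⟨Mjrty, Mjrty, Mjrty⟩, ⟨Mnrty, Mnrty, Mnrty⟩, ⟨Mjrty, Mjrty, Mnrty⟩. -/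
/-- The binary minimum operation on `Bool`. -/
def minOp : Op Bool 2 := fun x => x 0 && x 1

/-- The binary maximum operation on `Bool`. -/
def maxOp : Op Bool 2 := fun x => x 0 || x 1

/-- The unique ternary majority operation on `Bool`. -/
def mjrtyOp : Op Bool 3 := fun x => (x 0 && x 1) || (x 0 && x 2) || (x 1 && x 2)

/-- The unique ternary minority operation on `Bool`. -/
def mnrtyOp : Op Bool 3 := fun x => xor (xor (x 0) (x 1)) (x 2)
/-- The finite value of a cost function, with `0` in place of `∞`. -/
def finCost {r : ℕ} (ϱ : CostF Bool r) (x : Fin r → Bool) : ℚ := (ϱ x).untopD 0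

lemma coe_finCost {r : ℕ} {ϱ : CostF Bool r} {x : Fin r → Bool} (h : x ∈ Feas ϱ) :
    ((finCost ϱ x : ℚ) : WithTop ℚ) = ϱ x := by
  have h' : ϱ x ≠ ⊤ := h
  obtain ⟨q, hq⟩ := WithTop.ne_top_iff_exists.mp h'
  simp [finCost, ← hq]

/-- Identification of variables along `s`. -/
def minor {k l : ℕ} (f : Op Bool k) (s : Fin k → Fin l) : Op Bool l := fun x => f (x ∘ s)

lemma isProj_minor {k l : ℕ} {f : Op Bool k} (s : Fin k → Fin l) (h : IsProj f) :
    IsProj (minor f s) := by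
  obtain ⟨i, rfl⟩ := h
  exact ⟨s i, rfl⟩

lemma idem_minor {k l : ℕ} {f : Op Bool k} (s : Fin k → Fin l) (h : Idem f) :
    Idem (minor f s) := fun x => h x

lemma pol_minor {Γ : VLang Bool} {k l : ℕ} {f : Op Bool k} (s : Fin k → Fin l)
    (h : f ∈ Pol Γ k) : minor f s ∈ Pol Γ l :=
  fun ϱ hϱ xs hxs => h ϱ hϱ (xs ∘ s) fun i => hxs (s i)

lemma pol_superpose {Γ : VLang Bool} {k l : ℕ} {f : Op Bool k} {g : Fin k → Op Bool l}
    (hf : f ∈ Pol Γ k) (hg : ∀ i, g i ∈ Pol Γ l) : superposeOp f g ∈ Pol Γ l :=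
  fun ϱ hϱ xs hxs => hf ϱ hϱ (fun i => appRows (g i) xs) fun i => hg i ϱ hϱ xs hxs

lemma pol_proj (Γ : VLang Bool) {k : ℕ} (i : Fin k) : proj Bool i ∈ Pol Γ k :=
  fun _ _ _ hxs => hxs i

/-- A finite family of weighted operations whose pushforward to operations is a
weighted polymorphism. -/
structure WeightedFamily (Γ : VLang Bool) {ι : Type} [Fintype ι] {k : ℕ} (ω : ι → ℚ)
    (g : ι → Op Bool k) : Prop where
  sum_zero : ∑ i, ω i = 0
  isProj_of_neg : ∀ i, ω i < 0 → IsProj (g i)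
  mem_pol : ∀ i, ω i ≠ 0 → g i ∈ Pol Γ k
  sum_le : ∀ ϱ ∈ Γ, ∀ xs : Fin k → Fin ϱ.1 → Bool, (∀ i, xs i ∈ Feas ϱ.2) →
    ∑ i, ω i * finCost ϱ.2 (appRows (g i) xs) ≤ 0

/-- The pushforward of the weights of a family to operations. -/
def pushWeights {ι : Type} [Fintype ι] {k : ℕ} (ω : ι → ℚ) (g : ι → Op Bool k) :
    Op Bool k → ℚ :=
  fun h => ∑ i, if g i = h then ω i else 0

lemma sum_pushWeights {ι : Type} [Fintype ι] {k : ℕ} (ω : ι → ℚ) (g : ι → Op Bool k)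
    (φ : Op Bool k → ℚ) : ∑ h, pushWeights ω g h * φ h = ∑ i, ω i * φ (g i) := by
  simp only [pushWeights, Finset.sum_mul, ite_mul, zero_mul]
  rw [Finset.sum_comm]
  simp

lemma wSum_eq {Γ : VLang Bool} {k : ℕ} {ω : Op Bool k → ℚ}
    (hω : ∀ f, ω f ≠ 0 → f ∈ Pol Γ k) {ϱ : Σ r : ℕ, CostF Bool r} (hϱ : ϱ ∈ Γ)
    {xs : Fin k → Fin ϱ.1 → Bool} (hxs : ∀ i, xs i ∈ Feas ϱ.2) :
    wSum ω ϱ.2 xs = ((∑ f, ω f * finCost ϱ.2 (appRows f xs) : ℚ) : WithTop ℚ) := by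
  have h1 : ∑ f, ω f * finCost ϱ.2 (appRows f xs) =
      ∑ f ∈ Finset.univ.filter (fun f : Op Bool k => ω f ≠ 0),
        ω f * finCost ϱ.2 (appRows f xs) := by
    rw [Finset.sum_filter_of_ne]
    intro f _ hf h0
    simp [h0] at hf
  rw [h1, WithTop.coe_sum, wSum]
  refine Finset.sum_congr rfl fun f hf => ?_
  rw [← coe_finCost (hω f (Finset.mem_filter.mp hf).2 ϱ hϱ xs hxs), qmul, WithTop.map_coe]

namespace WeightedFamily

variable {Γ : VLang Bool} {ι : Type} [Fintype ι] {k : ℕ} {ω : ι → ℚ} {g : ι → Op Bool k}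

lemma pushWeights_mem (F : WeightedFamily Γ ω g) : pushWeights ω g ∈ wPol Γ k := by
  have hsupp : ∀ f, pushWeights ω g f ≠ 0 → f ∈ Pol Γ k := by
    intro f hf
    obtain ⟨i, -, hi⟩ := Finset.exists_ne_zero_of_sum_ne_zero hf
    by_cases h : g i = f
    · rw [if_pos h] at hi
      exact h ▸ F.mem_pol i hi
    · simp [h] at hi
  refine ⟨⟨hsupp, ?_, ?_⟩, ?_⟩
  · simpa [F.sum_zero] using sum_pushWeights ω g fun _ => 1
  · intro f hf
    by_contra hp
    refine absurd (Finset.sum_nonneg fun i _ => ?_) (not_le.mpr hf)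
    split_ifs with h
    · by_contra hneg
      exact hp (h ▸ F.isProj_of_neg i (not_le.mp hneg))
    · exact le_rfl
  · intro ϱ hϱ xs hxs
    rw [wSum_eq hsupp hϱ hxs, sum_pushWeights ω g fun f => finCost ϱ.2 (appRows f xs)]
    exact_mod_cast F.sum_le ϱ hϱ xs hxs

lemma mem_polPlus (F : WeightedFamily Γ ω g) {j : ι} (hj : 0 < ω j) : g j ∈ PolPlus Γ k := by
  by_cases hp : IsProj (g j)
  · exact Or.inl hp
  · refine Or.inr ⟨_, F.pushWeights_mem, Finset.sum_pos' (fun i _ => ?_) ⟨j, by simp, by simpa⟩⟩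
    split_ifs with h
    · by_contra hneg
      exact hp (h ▸ F.isProj_of_neg i (not_le.mp hneg))
    · exact le_rfl

lemma map_minor (F : WeightedFamily Γ ω g) {l : ℕ} (s : Fin k → Fin l) :
    WeightedFamily Γ ω fun i => minor (g i) s where
  sum_zero := F.sum_zero
  isProj_of_neg i hi := isProj_minor s (F.isProj_of_neg i hi)
  mem_pol i hi := pol_minor s (F.mem_pol i hi)
  sum_le ϱ hϱ xs hxs := F.sum_le ϱ hϱ (xs ∘ s) fun i => hxs (s i)

lemma nonneg_of_not_isProj (F : WeightedFamily Γ ω g) {i : ι} (h : ¬ IsProj (g i)) : 0 ≤ ω i := by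
  by_contra hneg
  exact h (F.isProj_of_neg i (not_le.mp hneg))

end WeightedFamily

lemma weightedFamily_of_mem_wPol {Γ : VLang Bool} {k : ℕ} {ω : Op Bool k → ℚ}
    (hω : ω ∈ wPol Γ k) : WeightedFamily Γ ω fun f => f where
  sum_zero := hω.1.sum_zero
  isProj_of_neg := hω.1.neg_imp_proj
  mem_pol := hω.1.support_mem
  sum_le ϱ hϱ xs hxs := by
    have h := hω.2 ϱ hϱ xs hxs
    rw [wSum_eq hω.1.support_mem hϱ hxs] at h
    exact_mod_cast h

lemma admitsMultimorphism_of_sum_le {Γ : VLang Bool} {k : ℕ} {F : Fin k → Op Bool k}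
    (hF : ∀ i, F i ∈ Pol Γ k)
    (h : ∀ ϱ ∈ Γ, ∀ xs : Fin k → Fin ϱ.1 → Bool, (∀ i, xs i ∈ Feas ϱ.2) →
      ∑ i, finCost ϱ.2 (appRows (F i) xs) ≤ ∑ i, finCost ϱ.2 (xs i)) :
    AdmitsMultimorphism Γ F := by
  have hfam : WeightedFamily Γ
      (Sum.elim (fun _ : Fin k => 1 / (k : ℚ)) fun _ : Fin k => -(1 / (k : ℚ)))
      (Sum.elim F fun i => proj Bool i) := by
    refine ⟨by simp, ?_, ?_, ?_⟩
    · rintro (i | i) hi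
      · exact absurd hi (not_lt.mpr (by simp))
      · exact ⟨i, rfl⟩
    · rintro (i | i) _
      · exact hF i
      · exact pol_proj Γ i
    · intro ϱ hϱ xs hxs
      have h1 := mul_le_mul_of_nonneg_left (h ϱ hϱ xs hxs) (by positivity : (0 : ℚ) ≤ 1 / k)
      simp only [Fintype.sum_sum_type, Sum.elim_inl, Sum.elim_inr, ← Finset.mul_sum]
      have h2 : ∀ i, appRows (proj Bool i) xs = xs i := fun _ => rfl
      simp only [h2]
      linarith
  have heq : multimorphismW F = pushWeights
      (Sum.elim (fun _ : Fin k => 1 / (k : ℚ)) fun _ : Fin k => -(1 / (k : ℚ)))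
      (Sum.elim F fun i => proj Bool i) := by
    funext f
    refine Eq.trans ?_ (Fintype.sum_sum_type _).symm
    change _ = (∑ i, if F i = f then 1 / (k : ℚ) else 0) +
      ∑ i, if proj Bool i = f then -(1 / (k : ℚ)) else 0
    simp only [multimorphismW, ← Finset.sum_filter, Finset.sum_const, nsmul_eq_mul]
    ring
  rw [AdmitsMultimorphism, heq]
  exact hfam.pushWeights_mem

lemma mem_polPlus_of_admitsMultimorphism {Γ : VLang Bool} {k : ℕ} {F : Fin k → Op Bool k}
    (h : AdmitsMultimorphism Γ F) (i : Fin k) : F i ∈ PolPlus Γ k := by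
  by_cases hp : IsProj (F i)
  · exact Or.inl hp
  · refine Or.inr ⟨_, h, ?_⟩
    have h0 : (Finset.univ.filter fun j : Fin k => proj Bool j = F i) = ∅ :=
      Finset.filter_eq_empty_iff.mpr fun j _ hj => hp ⟨j, hj.symm⟩
    have h1 : 0 < (Finset.univ.filter fun j : Fin k => F j = F i).card :=
      Finset.card_pos.mpr ⟨i, by simp⟩
    have hk : (0 : ℚ) < k := by exact_mod_cast i.pos
    rw [multimorphismW, h0]
    simp only [Finset.card_empty, Nat.cast_zero, sub_zero]
    positivity

lemma finRotate_apply_ne {k : ℕ} (hk : 1 < k) (i : Fin k) : finRotate k i ≠ i := by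
  obtain ⟨n, rfl⟩ : ∃ n, k = n + 2 := ⟨k - 2, by omega⟩
  rw [finRotate_apply]
  simp

lemma CyclicOp.not_isProj {k : ℕ} (hk : 1 < k) {f : Op Bool k} (hf : CyclicOp f) :
    ¬ IsProj f := by
  rintro ⟨i, rfl⟩
  have h : decide (i = i) = decide (finRotate k i = i) := hf fun j => decide (j = i)
  exact finRotate_apply_ne hk i ((decide_eq_decide.mp h).mp rfl)

/-- A cost-preserving modification of a family over a core making its operations idempotent. -/
lemma exists_idem_family {Γ : VLang Bool} (hcore : IsCore Γ) {k : ℕ} {f : Op Bool k}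
    {ω : Op Bool k → ℚ} (hω : ω ∈ wPol Γ k) (hf : Idem f) :
    ∃ g : Op Bool k → Op Bool k, WeightedFamily Γ ω g ∧ (∀ i, ω i ≠ 0 → Idem (g i)) ∧
      g f = f := by
  have F := weightedFamily_of_mem_wPol hω
  have F1 := F.map_minor fun _ => (0 : Fin 1)
  have hproj : ∀ h : Op Bool k, IsProj h → Idem h := by
    rintro _ ⟨i, rfl⟩ x
    rfl
  have hdiag : ∀ h, ω h ≠ 0 → (h fun _ => true) = !(h fun _ => false) := by
    intro h hh
    rcases lt_or_gt_of_ne hh with hneg | hpos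
    · have := hproj h (F.isProj_of_neg h hneg)
      rw [this, this]
      rfl
    · have hb := hcore _ (F1.mem_polPlus hpos)
      have hne : (h fun _ => true) ≠ h fun _ => false :=
        fun he => Bool.noConfusion (hb.1 (a₁ := true) (a₂ := false) he)
      exact Bool.eq_not_of_ne hne
  have hsymm : (∃ h, ω h ≠ 0 ∧ (h fun _ => false) = true) → ∀ ϱ ∈ Γ, ∀ x ∈ Feas ϱ.2,
      (fun j => !x j) ∈ Feas ϱ.2 ∧ finCost ϱ.2 (fun j => !x j) = finCost ϱ.2 x := by
    rintro ⟨h, hh, hh0⟩ ϱ hϱ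
    have happ : ∀ h, ω h ≠ 0 → ∀ x : Fin ϱ.1 → Bool,
        appRows (minor h fun _ => (0 : Fin 1)) (fun _ => x) =
          if h (fun _ => false) = true then (fun j => !x j) else x := by
      intro h hh x
      have := hdiag h hh
      funext j
      have e : appRows (minor h fun _ => (0 : Fin 1)) (fun _ => x) j = h fun _ => x j := rfl
      rw [e]
      cases hx : x j <;> cases h0 : h (fun _ => false) <;> simp_all
    have hfeas : ∀ x ∈ Feas ϱ.2, (fun j => !x j) ∈ Feas ϱ.2 := by
      intro x hx
      have := F1.mem_pol h hh ϱ hϱ (fun _ => x) fun _ => hx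
      rwa [happ h hh, if_pos hh0] at this
    have hle : ∀ x ∈ Feas ϱ.2, finCost ϱ.2 (fun j => !x j) ≤ finCost ϱ.2 x := by
      intro x hx
      have hs := F1.sum_le ϱ hϱ (fun _ => x) fun _ => hx
      have hterm : ∀ h, ω h * finCost ϱ.2 (appRows (minor h fun _ => (0 : Fin 1)) fun _ => x) =
          (if h (fun _ => false) = true then ω h else 0) *
            (finCost ϱ.2 (fun j => !x j) - finCost ϱ.2 x) + ω h * finCost ϱ.2 x := by
        intro h
        by_cases hh : ω h = 0
        · simp [hh]
        · rw [happ h hh]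
          split_ifs <;> ring
      simp only [hterm, Finset.sum_add_distrib, ← Finset.sum_mul, F.sum_zero] at hs
      have hpos : 0 < ∑ h : Op Bool k, if h (fun _ => false) = true then ω h else 0 := by
        have hnn : ∀ h : Op Bool k, h (fun _ => false) = true → 0 ≤ ω h := by
          intro h h0
          refine F.nonneg_of_not_isProj fun hp => ?_
          have := hproj h hp false
          simp_all
        refine Finset.sum_pos' (fun h _ => ?_) ⟨h, by simp, ?_⟩
        · split_ifs with h0
          · exact hnn h h0
          · exact le_rfl
        · rw [if_pos hh0]
          exact lt_of_le_of_ne (hnn h hh0) hh.symm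
      nlinarith
    refine fun x hx => ⟨hfeas x hx, le_antisymm (hle x hx) ?_⟩
    simpa using hle _ (hfeas x hx)
  let g : Op Bool k → Op Bool k := fun h x => xor (h x) (h fun _ => false)
  have hg : ∀ h : Op Bool k, (h fun _ => false) = false → g h = h := by
    intro h h0
    funext x
    simp [g, h0]
  have hg' : ∀ h : Op Bool k, (h fun _ => false) = true → ∀ {r : ℕ} (xs : Fin k → Fin r → Bool),
      appRows (g h) xs = fun j => !(appRows h xs j) := by
    intro h h0 r xs
    funext j
    simp [g, h0, appRows]
  refine ⟨g, ⟨F.sum_zero, ?_, ?_, ?_⟩, ?_, hg f (hf false)⟩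
  · intro h hh
    have hp := F.isProj_of_neg h hh
    rwa [hg h (hproj h hp false)]
  · intro h hh
    cases h0 : h (fun _ => false)
    · rw [hg h h0]
      exact F.mem_pol h hh
    · intro ϱ hϱ xs hxs
      rw [hg' h h0]
      exact (hsymm ⟨h, hh, h0⟩ ϱ hϱ _ (F.mem_pol h hh ϱ hϱ xs hxs)).1
  · intro ϱ hϱ xs hxs
    refine le_of_eq_of_le (Finset.sum_congr rfl fun h _ => ?_) (F.sum_le ϱ hϱ xs hxs)
    by_cases hh : ω h = 0
    · simp [hh]
    · cases h0 : h (fun _ => false)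
      · rw [hg h h0]
      · rw [hg' h h0, (hsymm ⟨h, hh, h0⟩ ϱ hϱ _ (F.mem_pol h hh ϱ hϱ xs hxs)).2]
  · intro h hh x
    have := hdiag h hh
    cases x <;> simp [g, this]

lemma sum_indicator_pos {ι : Type} [Fintype ι] {ω : ι → ℚ} {p : ι → Prop} [DecidablePred p]
    (hω : ∀ i, p i → 0 ≤ ω i) {j : ι} (hp : p j) (hj : 0 < ω j) :
    0 < ∑ i, if p i then ω i else 0 :=
  Finset.sum_pos' (fun i _ => by split_ifs with h; exacts [hω i h, le_rfl])
    ⟨j, by simp, by rwa [if_pos hp]⟩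

lemma sum_indicator_nonneg {ι : Type} [Fintype ι] {ω : ι → ℚ} {p : ι → Prop} [DecidablePred p]
    (hω : ∀ i, p i → 0 ≤ ω i) : 0 ≤ ∑ i, if p i then ω i else 0 :=
  Finset.sum_nonneg fun i _ => by split_ifs with h; exacts [hω i h, le_rfl]

lemma exists_of_sum_indicator_pos {ι : Type} [Fintype ι] {ω : ι → ℚ} {p : ι → Prop}
    [DecidablePred p] (h : 0 < ∑ i, if p i then ω i else 0) : ∃ i, p i ∧ ω i ≠ 0 := by
  obtain ⟨i, -, hi⟩ := Finset.exists_ne_zero_of_sum_ne_zero h.ne'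
  by_cases hp : p i
  · exact ⟨i, hp, by rwa [if_pos hp] at hi⟩
  · simp [hp] at hi

lemma eq_vec_two (x : Fin 2 → Bool) : x = ![x 0, x 1] := by
  funext i
  fin_cases i <;> rfl

lemma eq_vec_three (x : Fin 3 → Bool) : x = ![x 0, x 1, x 2] := by
  funext i
  fin_cases i <;> rfl

lemma Idem.binary_cases {h : Op Bool 2} (hi : Idem h) :
    h = minOp ∨ h = maxOp ∨ h = proj Bool 0 ∨ h = proj Bool 1 := by
  have h0 : h ![false, false] = false := by simpa [eq_vec_two] using hi false
  have h1 : h ![true, true] = true := by simpa [eq_vec_two] using hi true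
  have key : ∀ h' : Op Bool 2, h' ![false, false] = false → h' ![true, true] = true →
      h ![true, false] = h' ![true, false] → h ![false, true] = h' ![false, true] → h = h' := by
    intro h' e0 e1 e2 e3
    funext x
    rw [eq_vec_two x]
    cases x 0 <;> cases x 1 <;> simp_all
  cases ha : h ![true, false] <;> cases hb : h ![false, true]
  · exact Or.inl (key _ rfl rfl ha hb)
  · exact Or.inr (Or.inr (Or.inr (key _ rfl rfl ha hb)))
  · exact Or.inr (Or.inr (Or.inl (key _ rfl rfl ha hb)))
  · exact Or.inr (Or.inl (key _ rfl rfl ha hb))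

/-- An idempotent binary weighted polymorphism with a non-projection in its support yields one of
the binary multimorphisms. -/
lemma admits_of_binary {Γ : VLang Bool} {ι : Type} [Fintype ι] {ω : ι → ℚ} {g : ι → Op Bool 2}
    (F : WeightedFamily Γ ω g) (hid : ∀ i, ω i ≠ 0 → Idem (g i)) {j : ι} (hj : 0 < ω j)
    (hnp : ¬ IsProj (g j)) :
    AdmitsMultimorphism Γ ![minOp, minOp] ∨ AdmitsMultimorphism Γ ![maxOp, maxOp] ∨
      AdmitsMultimorphism Γ ![minOp, maxOp] := by
  have hmm : minOp ≠ maxOp := fun h => Bool.noConfusion (congrFun h ![true, false])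
  have hmin : ¬ IsProj minOp := CyclicOp.not_isProj (by norm_num) (by unfold CyclicOp; decide)
  have hmax : ¬ IsProj maxOp := CyclicOp.not_isProj (by norm_num) (by unfold CyclicOp; decide)
  set A := ∑ i, if g i = minOp then ω i else 0 with hA
  set B := ∑ i, if g i = maxOp then ω i else 0 with hB
  have hAi : ∀ i, g i = minOp → 0 ≤ ω i := fun i h => F.nonneg_of_not_isProj (h ▸ hmin)
  have hBi : ∀ i, g i = maxOp → 0 ≤ ω i := fun i h => F.nonneg_of_not_isProj (h ▸ hmax)
  have hA0 : 0 ≤ A := sum_indicator_nonneg hAi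
  have hB0 : 0 ≤ B := sum_indicator_nonneg hBi
  have hAB : 0 < A ∨ 0 < B := by
    rcases (hid j hj.ne').binary_cases with h | h | h | h
    · exact Or.inl (sum_indicator_pos hAi h hj)
    · exact Or.inr (sum_indicator_pos hBi h hj)
    · exact absurd ⟨_, h⟩ hnp
    · exact absurd ⟨_, h⟩ hnp
  have hApol : 0 < A → minOp ∈ Pol Γ 2 := fun h => by
    obtain ⟨i, hi, hi'⟩ := exists_of_sum_indicator_pos h
    exact hi ▸ F.mem_pol i hi'
  have hBpol : 0 < B → maxOp ∈ Pol Γ 2 := fun h => by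
    obtain ⟨i, hi, hi'⟩ := exists_of_sum_indicator_pos h
    exact hi ▸ F.mem_pol i hi'
  have key : ∀ ϱ ∈ Γ, ∀ xs : Fin 2 → Fin ϱ.1 → Bool, (∀ i, xs i ∈ Feas ϱ.2) →
      2 * A * finCost ϱ.2 (appRows minOp xs) + 2 * B * finCost ϱ.2 (appRows maxOp xs) ≤
        (A + B) * (finCost ϱ.2 (xs 0) + finCost ϱ.2 (xs 1)) := by
    intro ϱ hϱ xs hxs
    have h1 := F.sum_le ϱ hϱ xs hxs
    have h2 := F.sum_le ϱ hϱ (xs ∘ ![1, 0]) fun i => hxs _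
    have hterm : ∀ i, ω i * finCost ϱ.2 (appRows (g i) xs) +
        ω i * finCost ϱ.2 (appRows (g i) (xs ∘ ![1, 0])) =
        (if g i = minOp then ω i else 0) * (2 * finCost ϱ.2 (appRows minOp xs) -
          (finCost ϱ.2 (xs 0) + finCost ϱ.2 (xs 1))) +
        (if g i = maxOp then ω i else 0) * (2 * finCost ϱ.2 (appRows maxOp xs) -
          (finCost ϱ.2 (xs 0) + finCost ϱ.2 (xs 1))) +
        ω i * (finCost ϱ.2 (xs 0) + finCost ϱ.2 (xs 1)) := by
      intro i
      by_cases hi : ω i = 0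
      · simp [hi]
      have e1 : appRows minOp (xs ∘ ![1, 0]) = appRows minOp xs := by
        funext t; exact Bool.and_comm _ _
      have e2 : appRows maxOp (xs ∘ ![1, 0]) = appRows maxOp xs := by
        funext t; exact Bool.or_comm _ _
      rcases (hid i hi).binary_cases with h | h | h | h
      · rw [h, if_pos rfl, if_neg hmm, e1]; ring
      · rw [h, if_pos rfl, if_neg hmm.symm, e2]; ring
      · rw [h, if_neg fun h => hmin ⟨_, h.symm⟩, if_neg fun h => hmax ⟨_, h.symm⟩]
        change ω i * finCost ϱ.2 (xs 0) + ω i * finCost ϱ.2 (xs 1) = _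
        ring
      · rw [h, if_neg fun h => hmin ⟨_, h.symm⟩, if_neg fun h => hmax ⟨_, h.symm⟩]
        change ω i * finCost ϱ.2 (xs 1) + ω i * finCost ϱ.2 (xs 0) = _
        ring
    have h3 := add_le_add h1 h2
    rw [← Finset.sum_add_distrib] at h3
    simp only [hterm, Finset.sum_add_distrib, ← Finset.sum_mul, F.sum_zero, ← hA, ← hB] at h3
    linarith
  have hmono : ∀ ϱ ∈ Γ, ∀ x ∈ Feas ϱ.2, ∀ y ∈ Feas ϱ.2, x ≤ y →
      (A - B) * finCost ϱ.2 x ≤ (A - B) * finCost ϱ.2 y := by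
    intro ϱ hϱ x hx y hy hxy
    have h := key ϱ hϱ ![x, y] fun i => by fin_cases i <;> assumption
    have e1 : appRows minOp ![x, y] = x := by
      funext t; exact inf_eq_left.mpr (hxy t)
    have e2 : appRows maxOp ![x, y] = y := by
      funext t; exact sup_eq_right.mpr (hxy t)
    simp only [e1, e2, Matrix.cons_val_zero, Matrix.cons_val_one] at h
    linarith
  rcases lt_trichotomy A B with hlt | heq | hgt
  · refine Or.inr (Or.inl (admitsMultimorphism_of_sum_le ?_ ?_))
    · intro i; fin_cases i <;> exact hBpol (by linarith)
    · intro ϱ hϱ xs hxs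
      have hf := hBpol (by linarith) ϱ hϱ xs hxs
      have a := hmono ϱ hϱ _ (hxs 0) _ hf fun t => le_sup_left (a := xs 0 t) (b := xs 1 t)
      have b := hmono ϱ hϱ _ (hxs 1) _ hf fun t => le_sup_right (a := xs 0 t) (b := xs 1 t)
      simp only [Fin.sum_univ_two, Matrix.cons_val_zero, Matrix.cons_val_one]
      nlinarith
  · refine Or.inr (Or.inr (admitsMultimorphism_of_sum_le ?_ ?_))
    · intro i
      fin_cases i
      · exact hApol (by rcases hAB with h | h <;> linarith)
      · exact hBpol (by rcases hAB with h | h <;> linarith)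
    · intro ϱ hϱ xs hxs
      have := key ϱ hϱ xs hxs
      have hB' : 0 < B := by rcases hAB with h | h <;> linarith
      rw [heq] at this
      simp only [Fin.sum_univ_two, Matrix.cons_val_zero, Matrix.cons_val_one]
      refine le_of_mul_le_mul_left ?_ hB'
      linarith
  · refine Or.inl (admitsMultimorphism_of_sum_le ?_ ?_)
    · intro i; fin_cases i <;> exact hApol (by linarith)
    · intro ϱ hϱ xs hxs
      have hf := hApol (by linarith) ϱ hϱ xs hxs
      have a := hmono ϱ hϱ _ hf _ (hxs 0) fun t => inf_le_left (a := xs 0 t) (b := xs 1 t)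
      have b := hmono ϱ hϱ _ hf _ (hxs 1) fun t => inf_le_right (a := xs 0 t) (b := xs 1 t)
      simp only [Fin.sum_univ_two, Matrix.cons_val_zero, Matrix.cons_val_one]
      nlinarith

/-- An operation commuting with negation. -/
def SelfDual {k : ℕ} (f : Op Bool k) : Prop := ∀ x, f (fun i => !x i) = !f x

/-- The self-dual idempotent ternary operation agreeing with `mjrtyOp` where its `i`-th argument
is the odd one out, and with `mnrtyOp` elsewhere. -/
def pixleyOp (i : Fin 3) : Op Bool 3 := fun x => xor (xor (mjrtyOp x) (mnrtyOp x)) (x i)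

lemma SelfDual.ternary_cases {h : Op Bool 3} (hs : SelfDual h) (hi : Idem h) :
    h = mjrtyOp ∨ h = mnrtyOp ∨ (∃ i, h = pixleyOp i) ∨ ∃ i, h = proj Bool i := by
  have key : ∀ h' : Op Bool 3, SelfDual h' → Idem h' →
      h ![true, false, false] = h' ![true, false, false] →
      h ![false, true, false] = h' ![false, true, false] →
      h ![false, false, true] = h' ![false, false, true] → h = h' := by
    have neg : ∀ a b c : Bool, (fun i => !(![a, b, c] i)) = ![!a, !b, !c] := by
      intro a b c; rw [eq_vec_three fun i => !(![a, b, c] i)]; rfl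
    have const : ∀ a : Bool, (fun _ : Fin 3 => a) = ![a, a, a] := by
      intro a; rw [eq_vec_three fun _ => a]
    have dual : ∀ h : Op Bool 3, SelfDual h → ∀ a b c, h ![!a, !b, !c] = !h ![a, b, c] := by
      intro h hs a b c; rw [← neg]; exact hs _
    intro h' hs' hi' e1 e2 e3
    have i0 := fun a => (const a) ▸ hi a
    have i1 := fun a => (const a) ▸ hi' a
    have d1 := (dual h hs true false false).trans
      ((congrArg _ e1).trans (dual h' hs' true false false).symm)
    have d2 := (dual h hs false true false).trans
      ((congrArg _ e2).trans (dual h' hs' false true false).symm)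
    have d3 := (dual h hs false false true).trans
      ((congrArg _ e3).trans (dual h' hs' false false true).symm)
    simp only [Bool.not_true, Bool.not_false] at d1 d2 d3
    funext x
    rw [eq_vec_three x]
    cases x 0 <;> cases x 1 <;> cases x 2 <;> first | assumption | (rw [i0, i1])
  have sM : SelfDual mjrtyOp := by unfold SelfDual; decide
  have sm : SelfDual mnrtyOp := by unfold SelfDual; decide
  have sp : ∀ i, SelfDual (pixleyOp i) := by unfold SelfDual; decide
  have iM : Idem mjrtyOp := by unfold Idem; decide
  have im : Idem mnrtyOp := by unfold Idem; decide
  have ip : ∀ i, Idem (pixleyOp i) := by unfold Idem; decide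
  have sj : ∀ i : Fin 3, SelfDual (proj Bool i) := fun _ _ => rfl
  have ij : ∀ i : Fin 3, Idem (proj Bool i) := fun _ _ => rfl
  cases ha : h ![true, false, false] <;> cases hb : h ![false, true, false] <;>
    cases hc : h ![false, false, true]
  · exact Or.inl (key _ sM iM ha hb hc)
  · exact Or.inr (Or.inr (Or.inr ⟨2, key _ (sj 2) (ij 2) ha hb hc⟩))
  · exact Or.inr (Or.inr (Or.inr ⟨1, key _ (sj 1) (ij 1) ha hb hc⟩))
  · exact Or.inr (Or.inr (Or.inl ⟨0, key _ (sp 0) (ip 0) ha hb hc⟩))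
  · exact Or.inr (Or.inr (Or.inr ⟨0, key _ (sj 0) (ij 0) ha hb hc⟩))
  · exact Or.inr (Or.inr (Or.inl ⟨1, key _ (sp 1) (ip 1) ha hb hc⟩))
  · exact Or.inr (Or.inr (Or.inl ⟨2, key _ (sp 2) (ip 2) ha hb hc⟩))
  · exact Or.inr (Or.inl (key _ sm im ha hb hc))

lemma mjrtyOp_comp_finRotate (x : Fin 3 → Bool) : mjrtyOp (x ∘ finRotate 3) = mjrtyOp x := by
  revert x; decide

lemma mnrtyOp_comp_finRotate (x : Fin 3 → Bool) : mnrtyOp (x ∘ finRotate 3) = mnrtyOp x := by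
  revert x; decide

lemma pixleyOp_comp_finRotate (i : Fin 3) (x : Fin 3 → Bool) :
    pixleyOp i (x ∘ finRotate 3) = pixleyOp (finRotate 3 i) x := by
  simp only [pixleyOp, mjrtyOp_comp_finRotate, mnrtyOp_comp_finRotate, Function.comp]

/-- The sum of the costs of an operation over the cyclic shifts of its arguments. -/
def rotCost {r : ℕ} (ϱ : CostF Bool r) (f : Op Bool 3) (xs : Fin 3 → Fin r → Bool) : ℚ :=
  finCost ϱ (appRows f xs) + finCost ϱ (appRows f (xs ∘ finRotate 3)) +
    finCost ϱ (appRows f ((xs ∘ finRotate 3) ∘ finRotate 3))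

lemma rotCost_of_cyclic {r : ℕ} (ϱ : CostF Bool r) {f : Op Bool 3} (hf : CyclicOp f)
    (xs : Fin 3 → Fin r → Bool) : rotCost ϱ f xs = 3 * finCost ϱ (appRows f xs) := by
  have h : ∀ xs : Fin 3 → Fin r → Bool, appRows f (xs ∘ finRotate 3) = appRows f xs :=
    fun xs => funext fun t => (hf fun i => xs i t).symm
  rw [rotCost, h, h, h]
  ring

lemma sum_finRotate_three (φ : Fin 3 → ℚ) (i : Fin 3) :
    φ i + φ (finRotate 3 i) + φ (finRotate 3 (finRotate 3 i)) = ∑ j, φ j := by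
  simp only [finRotate_apply, Fin.sum_univ_three]
  fin_cases i
  · rfl
  · change φ 1 + φ 2 + φ 0 = _
    ring
  · change φ 2 + φ 0 + φ 1 = _
    ring

lemma rotCost_proj {r : ℕ} (ϱ : CostF Bool r) (i : Fin 3) (xs : Fin 3 → Fin r → Bool) :
    rotCost ϱ (proj Bool i) xs = ∑ j, finCost ϱ (xs j) :=
  sum_finRotate_three (fun j => finCost ϱ (xs j)) i

lemma rotCost_pixleyOp {r : ℕ} (ϱ : CostF Bool r) (i : Fin 3) (xs : Fin 3 → Fin r → Bool) :
    rotCost ϱ (pixleyOp i) xs = ∑ j, finCost ϱ (appRows (pixleyOp j) xs) := by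
  have h : ∀ i (xs : Fin 3 → Fin r → Bool),
      appRows (pixleyOp i) (xs ∘ finRotate 3) = appRows (pixleyOp (finRotate 3 i)) xs :=
    fun i xs => funext fun t => pixleyOp_comp_finRotate i fun i => xs i t
  rw [rotCost, h, h, h]
  exact sum_finRotate_three (fun j => finCost ϱ (appRows (pixleyOp j) xs)) i

lemma cyclicOp_mjrtyOp : CyclicOp mjrtyOp := fun x => (mjrtyOp_comp_finRotate x).symm

lemma cyclicOp_mnrtyOp : CyclicOp mnrtyOp := fun x => (mnrtyOp_comp_finRotate x).symm

lemma pol_pixleyOp {Γ : VLang Bool} {i : Fin 3} (h : pixleyOp i ∈ Pol Γ 3) (j : Fin 3) :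
    pixleyOp j ∈ Pol Γ 3 := by
  have hs : ∀ i : Fin 3, pixleyOp i ∈ Pol Γ 3 → pixleyOp (finRotate 3 i) ∈ Pol Γ 3 := by
    intro i hi
    have := pol_minor (finRotate 3) hi
    rwa [show minor (pixleyOp i) (finRotate 3) = pixleyOp (finRotate 3 i) from
      funext fun x => pixleyOp_comp_finRotate i x] at this
  have h1 := hs _ h
  have h2 := hs _ h1
  have : j = i ∨ j = finRotate 3 i ∨ j = finRotate 3 (finRotate 3 i) := by
    clear h h1 h2
    revert i j
    decide
  rcases this with rfl | rfl | rfl <;> assumption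

lemma mjrtyOp_mem_of_pixleyOp {Γ : VLang Bool} (h : ∀ i, pixleyOp i ∈ Pol Γ 3) :
    mjrtyOp ∈ Pol Γ 3 := by
  have := pol_superpose (g := ![proj Bool 0, proj Bool 1, pixleyOp 2]) (h 2) fun i => by
    fin_cases i
    exacts [pol_proj Γ 0, pol_proj Γ 1, h 2]
  convert this using 1
  funext x
  revert x
  unfold superposeOp
  decide

lemma mnrtyOp_mem_of_pixleyOp {Γ : VLang Bool} (h : ∀ i, pixleyOp i ∈ Pol Γ 3)
    (hM : mjrtyOp ∈ Pol Γ 3) : mnrtyOp ∈ Pol Γ 3 := by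
  have := pol_superpose hM h
  convert this using 1
  funext x
  revert x
  unfold superposeOp
  decide

/-- A self-dual idempotent ternary weighted polymorphism with a non-projection in its support
yields one of the ternary multimorphisms. -/
lemma admits_of_ternary {Γ : VLang Bool} {ι : Type} [Fintype ι] {ω : ι → ℚ} {g : ι → Op Bool 3}
    (F : WeightedFamily Γ ω g) (hid : ∀ i, ω i ≠ 0 → Idem (g i))
    (hsd : ∀ i, ω i ≠ 0 → SelfDual (g i)) {j : ι} (hj : 0 < ω j) (hnp : ¬ IsProj (g j)) :
    AdmitsMultimorphism Γ ![mjrtyOp, mjrtyOp, mjrtyOp] ∨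
      AdmitsMultimorphism Γ ![mnrtyOp, mnrtyOp, mnrtyOp] ∨
      AdmitsMultimorphism Γ ![mjrtyOp, mjrtyOp, mnrtyOp] := by
  have hMm : mjrtyOp ≠ mnrtyOp := by decide
  have hMp : ∀ i, mjrtyOp ≠ pixleyOp i := by decide
  have hmp : ∀ i, mnrtyOp ≠ pixleyOp i := by decide
  have hM : ¬ IsProj mjrtyOp := cyclicOp_mjrtyOp.not_isProj (by norm_num)
  have hm : ¬ IsProj mnrtyOp := cyclicOp_mnrtyOp.not_isProj (by norm_num)
  have hpp : ∀ i k, pixleyOp i ≠ proj Bool k := by decide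
  have hp : ∀ i, ¬ IsProj (pixleyOp i) := fun i ⟨k, hk⟩ => hpp i k hk
  set A := ∑ i, if g i = mjrtyOp then ω i else 0 with hA
  set B := ∑ i, if g i = mnrtyOp then ω i else 0 with hB
  set C := ∑ i, if ∃ t, g i = pixleyOp t then ω i else 0 with hC
  have hAi : ∀ i, g i = mjrtyOp → 0 ≤ ω i := fun i h => F.nonneg_of_not_isProj (h ▸ hM)
  have hBi : ∀ i, g i = mnrtyOp → 0 ≤ ω i := fun i h => F.nonneg_of_not_isProj (h ▸ hm)
  have hCi : ∀ i, (∃ t, g i = pixleyOp t) → 0 ≤ ω i := fun i ⟨t, h⟩ =>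
    F.nonneg_of_not_isProj (h ▸ hp t)
  have hA0 : 0 ≤ A := sum_indicator_nonneg hAi
  have hB0 : 0 ≤ B := sum_indicator_nonneg hBi
  have hC0 : 0 ≤ C := sum_indicator_nonneg hCi
  have hABC : 0 < A ∨ 0 < B ∨ 0 < C := by
    rcases (hsd j hj.ne').ternary_cases (hid j hj.ne') with h | h | h | h
    · exact Or.inl (sum_indicator_pos hAi h hj)
    · exact Or.inr (Or.inl (sum_indicator_pos hBi h hj))
    · exact Or.inr (Or.inr (sum_indicator_pos hCi h hj))
    · exact absurd h hnp
  have hApol : 0 < A → mjrtyOp ∈ Pol Γ 3 := fun h => by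
    obtain ⟨i, hi, hi'⟩ := exists_of_sum_indicator_pos h
    exact hi ▸ F.mem_pol i hi'
  have hBpol : 0 < B → mnrtyOp ∈ Pol Γ 3 := fun h => by
    obtain ⟨i, hi, hi'⟩ := exists_of_sum_indicator_pos h
    exact hi ▸ F.mem_pol i hi'
  have hCpol : 0 < C → ∀ t, pixleyOp t ∈ Pol Γ 3 := fun h => by
    obtain ⟨i, ⟨t, hi⟩, hi'⟩ := exists_of_sum_indicator_pos h
    exact pol_pixleyOp (hi ▸ F.mem_pol i hi')
  have key : ∀ ϱ ∈ Γ, ∀ xs : Fin 3 → Fin ϱ.1 → Bool, (∀ i, xs i ∈ Feas ϱ.2) →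
      3 * A * finCost ϱ.2 (appRows mjrtyOp xs) + 3 * B * finCost ϱ.2 (appRows mnrtyOp xs) +
        C * ∑ t, finCost ϱ.2 (appRows (pixleyOp t) xs) ≤
        (A + B + C) * ∑ t, finCost ϱ.2 (xs t) := by
    intro ϱ hϱ xs hxs
    have h1 := F.sum_le ϱ hϱ xs hxs
    have h2 := F.sum_le ϱ hϱ (xs ∘ finRotate 3) fun i => hxs _
    have h3 := F.sum_le ϱ hϱ ((xs ∘ finRotate 3) ∘ finRotate 3) fun i => hxs _
    have h4 := add_le_add (add_le_add h1 h2) h3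
    rw [← Finset.sum_add_distrib, ← Finset.sum_add_distrib] at h4
    set X := ∑ t, finCost ϱ.2 (xs t) with hX
    set P := ∑ t, finCost ϱ.2 (appRows (pixleyOp t) xs) with hP
    have hterm : ∀ i, ω i * finCost ϱ.2 (appRows (g i) xs) +
        ω i * finCost ϱ.2 (appRows (g i) (xs ∘ finRotate 3)) +
        ω i * finCost ϱ.2 (appRows (g i) ((xs ∘ finRotate 3) ∘ finRotate 3)) =
        (if g i = mjrtyOp then ω i else 0) * (3 * finCost ϱ.2 (appRows mjrtyOp xs) - X) +
        (if g i = mnrtyOp then ω i else 0) * (3 * finCost ϱ.2 (appRows mnrtyOp xs) - X) +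
        (if ∃ t, g i = pixleyOp t then ω i else 0) * (P - X) + ω i * X := by
      intro i
      by_cases hi : ω i = 0
      · simp [hi]
      rw [← mul_add, ← mul_add, ← rotCost]
      rcases (hsd i hi).ternary_cases (hid i hi) with h | h | ⟨t, h⟩ | ⟨t, h⟩
      · rw [h, if_pos rfl, if_neg hMm, if_neg fun ⟨t, h⟩ => hMp t h,
          rotCost_of_cyclic _ cyclicOp_mjrtyOp]
        ring
      · rw [h, if_pos rfl, if_neg hMm.symm, if_neg fun ⟨t, h⟩ => hmp t h,
          rotCost_of_cyclic _ cyclicOp_mnrtyOp]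
        ring
      · rw [h, if_neg (hMp t).symm, if_neg (hmp t).symm, if_pos ⟨t, rfl⟩, rotCost_pixleyOp]
        ring
      · rw [h, if_neg fun h => hM ⟨_, h.symm⟩, if_neg fun h => hm ⟨_, h.symm⟩,
          if_neg fun ⟨s, h⟩ => hp s ⟨_, h.symm⟩, rotCost_proj]
        ring
    simp only [hterm, Finset.sum_add_distrib, ← Finset.sum_mul, F.sum_zero, ← hA, ← hB, ← hC]
      at h4
    linarith
  have hconst : ∀ ϱ ∈ Γ, ∀ u ∈ Feas ϱ.2, ∀ v ∈ Feas ϱ.2,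
      (A - 2 * B - C) * (finCost ϱ.2 u - finCost ϱ.2 v) ≤ 0 := by
    intro ϱ hϱ u hu v hv
    have h := key ϱ hϱ ![u, v, u] fun i => by fin_cases i <;> assumption
    have eM : ∀ a b : Bool, mjrtyOp ![a, b, a] = a := by decide
    have em : ∀ a b : Bool, mnrtyOp ![a, b, a] = b := by decide
    have e0 : ∀ a b : Bool, pixleyOp 0 ![a, b, a] = b := by decide
    have e1 : ∀ a b : Bool, pixleyOp 1 ![a, b, a] = a := by decide
    have e2 : ∀ a b : Bool, pixleyOp 2 ![a, b, a] = b := by decide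
    have app : ∀ f : Op Bool 3, appRows f ![u, v, u] = fun t => f ![u t, v t, u t] := by
      intro f
      funext t
      rw [appRows, eq_vec_three fun i => ![u, v, u] i t]
      rfl
    simp only [Fin.sum_univ_three, app, eM, em, e0, e1, e2, Matrix.cons_val] at h
    linarith
  by_cases hbal : A - 2 * B - C = 0
  · have hApos : 0 < A := by rcases hABC with h | h | h <;> linarith
    have hMpol := hApol hApos
    rcases hC0.eq_or_lt with hCz | hCpos
    · have hBpos : 0 < B := by linarith
      refine Or.inr (Or.inr (admitsMultimorphism_of_sum_le ?_ ?_))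
      · intro i
        fin_cases i
        exacts [hMpol, hMpol, hBpol hBpos]
      · intro ϱ hϱ xs hxs
        have h := key ϱ hϱ xs hxs
        have hA2 : A = 2 * B := by linarith
        rw [← hCz, hA2] at h
        rw [Fin.sum_univ_three]
        simp only [Matrix.cons_val]
        refine le_of_mul_le_mul_left ?_ hBpos
        linarith
    · have hppol := hCpol hCpos
      refine Or.inr (Or.inr (admitsMultimorphism_of_sum_le ?_ ?_))
      · intro i
        fin_cases i
        exacts [hMpol, hMpol, mnrtyOp_mem_of_pixleyOp hppol hMpol]
      · intro ϱ hϱ xs hxs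
        have h := key ϱ hϱ xs hxs
        have h' := key ϱ hϱ (fun i => appRows (pixleyOp i) xs) fun i => hppol i ϱ hϱ xs hxs
        have eM : ∀ x, mjrtyOp (fun i => pixleyOp i x) = mnrtyOp x := by decide
        have em : ∀ x, mnrtyOp (fun i => pixleyOp i x) = mjrtyOp x := by decide
        have ep : ∀ t x, pixleyOp t (fun i => pixleyOp i x) = x t := by decide
        have aM : appRows mjrtyOp (fun i => appRows (pixleyOp i) xs) = appRows mnrtyOp xs :=
          funext fun t => eM fun i => xs i t
        have am : appRows mnrtyOp (fun i => appRows (pixleyOp i) xs) = appRows mjrtyOp xs :=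
          funext fun t => em fun i => xs i t
        have ap : ∀ s, appRows (pixleyOp s) (fun i => appRows (pixleyOp i) xs) = xs s :=
          fun s => funext fun t => ep s fun i => xs i t
        simp only [aM, am, ap] at h'
        have hA2 : A = 2 * B + C := by linarith
        rw [hA2] at h h'
        have e : ∑ i, finCost ϱ.2 (appRows (![mjrtyOp, mjrtyOp, mnrtyOp] i) xs) =
            2 * finCost ϱ.2 (appRows mjrtyOp xs) + finCost ϱ.2 (appRows mnrtyOp xs) := by
          rw [Fin.sum_univ_three]
          simp only [Matrix.cons_val]
          ring
        rw [e]
        have c1 : 0 ≤ 3 * B + 2 * C := by positivity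
        have c2 : 0 < 3 * (3 * B + C) * (B + C) := by positivity
        refine le_of_mul_le_mul_left ?_ c2
        linarith [mul_le_mul_of_nonneg_left h c1, mul_le_mul_of_nonneg_left h' hC0]
  · have hc : ∀ ϱ ∈ Γ, ∀ u ∈ Feas ϱ.2, ∀ v ∈ Feas ϱ.2, finCost ϱ.2 u = finCost ϱ.2 v := by
      intro ϱ hϱ u hu v hv
      have h1 := hconst ϱ hϱ u hu v hv
      have h2 := hconst ϱ hϱ v hv u hu
      have h3 : (A - 2 * B - C) * (finCost ϱ.2 u - finCost ϱ.2 v) = 0 := by linarith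
      exact sub_eq_zero.mp ((mul_eq_zero.mp h3).resolve_left hbal)
    have adm : ∀ f : Op Bool 3, f ∈ Pol Γ 3 → AdmitsMultimorphism Γ ![f, f, f] := by
      intro f hf
      have hF : ∀ i, ![f, f, f] i ∈ Pol Γ 3 := by intro i; fin_cases i <;> exact hf
      refine admitsMultimorphism_of_sum_le hF fun ϱ hϱ xs hxs => ?_
      exact (Finset.sum_congr rfl fun i _ => hc ϱ hϱ _ (hF i ϱ hϱ xs hxs) _ (hxs i)).le
    rcases hABC with h | h | h
    · exact Or.inl (adm _ (hApol h))
    · exact Or.inr (Or.inl (adm _ (hBpol h)))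
    · exact Or.inl (adm _ (mjrtyOp_mem_of_pixleyOp (hCpol h)))

lemma selfDual_of_isProj_minor {k : ℕ} {f : Op Bool k}
    (h : ∀ s : Fin k → Fin 2, IsProj (minor f s)) : SelfDual f := by
  intro x
  obtain ⟨i, hi⟩ := h fun t => if x t then 1 else 0
  have h1 := congrFun hi ![false, true]
  have h2 := congrFun hi ![true, false]
  have e1 : (![false, true] ∘ fun t => if x t then (1 : Fin 2) else 0) = x := by
    funext t; cases hx : x t <;> simp [hx]
  have e2 : (![true, false] ∘ fun t => if x t then (1 : Fin 2) else 0) = fun t => !x t := by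
    funext t; cases hx : x t <;> simp [hx]
  rw [minor, e1] at h1
  rw [minor, e2] at h2
  rw [h1, h2]
  fin_cases i <;> rfl

/-- A self-dual idempotent cyclic operation has a ternary minor that is not a projection. -/
lemma exists_ternary_minor {k : ℕ} (hk : 1 < k) {f : Op Bool k} (hi : Idem f)
    (hs : SelfDual f) (hc : CyclicOp f) : ∃ s : Fin k → Fin 3, ¬ IsProj (minor f s) := by
  by_contra! hall
  have hex : ∃ n : ℕ, f (fun t => decide (t.val < n)) = true :=
    ⟨k, by simpa using hi true⟩
  classical
  obtain ⟨n, hn, hmin⟩ : ∃ n, f (fun t => decide (t.val < n + 1)) = true ∧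
      f (fun t => decide (t.val < n)) = false := by
    rcases h : Nat.find hex with _ | n
    · have := Nat.find_spec hex
      rw [h] at this
      simp [hi false] at this
    · refine ⟨n, h ▸ Nat.find_spec hex, ?_⟩
      simpa using Nat.find_min hex (m := n) (by omega)
  have hnk : n < k := by
    by_contra hge
    have : (fun t : Fin k => decide (t.val < n + 1)) = fun t => decide (t.val < n) := by
      funext t
      have := t.isLt
      simp only [decide_eq_decide]
      omega
    rw [this, hmin] at hn
    exact Bool.noConfusion hn
  have hsing : f (fun t => decide (t = ⟨n, hnk⟩)) = true := by
    obtain ⟨i, h⟩ := hall fun t => if t.val < n then 0 else if t.val = n then 1 else 2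
    have h0 := congrFun h ![true, false, false]
    have h1 := congrFun h ![false, true, false]
    have h2 := congrFun h ![false, false, true]
    simp only [minor] at h0 h1 h2
    rw [show (![true, false, false] ∘ fun t : Fin k =>
        if t.val < n then (0 : Fin 3) else if t.val = n then 1 else 2) =
        fun t => decide (t.val < n) by
      funext t
      by_cases c1 : t.val < n <;> by_cases c2 : t.val = n <;> simp [c1, c2], hmin] at h0
    rw [show (![false, true, false] ∘ fun t : Fin k =>
        if t.val < n then (0 : Fin 3) else if t.val = n then 1 else 2) =
        fun t => decide (t = ⟨n, hnk⟩) by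
      funext t
      simp only [Fin.ext_iff]
      by_cases c1 : t.val < n
      · simp [c1, c1.ne]
      · by_cases c2 : t.val = n <;> simp [c1, c2]] at h1
    rw [show (![false, false, true] ∘ fun t : Fin k =>
        if t.val < n then (0 : Fin 3) else if t.val = n then 1 else 2) =
        fun t => !decide (t.val < n + 1) by
      funext t
      by_cases c1 : t.val < n
      · simp [c1, Nat.lt_succ_of_lt c1]
      · by_cases c2 : t.val = n
        · simp [c2]
        · have : ¬ t.val < n + 1 := by omega
          simp [c1, c2, this], hs, hn] at h2
    rw [h1]
    fin_cases i
    · exact absurd h0 (by decide)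
    · rfl
    · exact absurd h2 (by decide)
  set a : Fin k := ⟨n, hnk⟩
  set b : Fin k := (finRotate k).symm a with hb
  have hba : b ≠ a := fun h => finRotate_apply_ne hk b (by rw [hb, Equiv.apply_symm_apply, ← hb, h])
  have hsing' : f (fun t => decide (t = b)) = true := by
    rw [hc] at hsing
    rw [← hsing]
    congr 1
    funext t
    simp only [hb, Equiv.eq_symm_apply, Function.comp]
  obtain ⟨i, h⟩ := hall fun t => if t = a then 0 else if t = b then 1 else 2
  have h0 := congrFun h ![true, false, false]
  have h1 := congrFun h ![false, true, false]
  simp only [minor] at h0 h1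
  rw [show (![true, false, false] ∘ fun t : Fin k =>
      if t = a then (0 : Fin 3) else if t = b then 1 else 2) = fun t => decide (t = a) by
    funext t
    by_cases c1 : t = a
    · simp [c1]
    · by_cases c2 : t = b
      · rw [Function.comp, if_neg c1, if_pos c2, decide_eq_false c1]
        rfl
      · simp [c1, c2], hsing] at h0
  rw [show (![false, true, false] ∘ fun t : Fin k =>
      if t = a then (0 : Fin 3) else if t = b then 1 else 2) = fun t => decide (t = b) by
    funext t
    by_cases c1 : t = a
    · simp [c1, hba.symm]
    · by_cases c2 : t = b
      · rw [Function.comp, if_neg c1, if_pos c2, decide_eq_true c2]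
        rfl
      · simp [c1, c2], hsing'] at h1
  fin_cases i
  · exact absurd h1 (by decide)
  · exact absurd h0 (by decide)
  · exact absurd h0 (by decide)

/-- A finite core language on the two-element domain has an idempotent cyclic
operation in its positive clone iff it admits one of the six listed multimorphisms. -/
theorem boolean_cyclic_iff_multimorphism (Γ : VLang Bool) (hfin : Γ.Finite)
    (hcore : IsCore Γ) :
    (∃ k : ℕ, 1 < k ∧ ∃ f ∈ PolPlus Γ k, Idem f ∧ CyclicOp f) ↔
      (AdmitsMultimorphism Γ ![minOp, minOp] ∨
       AdmitsMultimorphism Γ ![maxOp, maxOp] ∨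
       AdmitsMultimorphism Γ ![minOp, maxOp] ∨
       AdmitsMultimorphism Γ ![mjrtyOp, mjrtyOp, mjrtyOp] ∨
       AdmitsMultimorphism Γ ![mnrtyOp, mnrtyOp, mnrtyOp] ∨
       AdmitsMultimorphism Γ ![mjrtyOp, mjrtyOp, mnrtyOp]) := by
  constructor
  · rintro ⟨k, hk, f, hf, hi, hc⟩
    rcases hf with hp | ⟨ω, hω, hpos⟩
    · exact absurd hp (hc.not_isProj hk)
    obtain ⟨g, F, hid, hgf⟩ := exists_idem_family hcore hω hi
    by_cases hbin : ∀ h, ω h ≠ 0 → ∀ s : Fin k → Fin 2, IsProj (minor (g h) s)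
    · have hsd : ∀ h, ω h ≠ 0 → SelfDual (g h) := fun h hh => selfDual_of_isProj_minor (hbin h hh)
      obtain ⟨s, hs⟩ := exists_ternary_minor hk hi (hgf ▸ hsd f hpos.ne') hc
      have := admits_of_ternary (F.map_minor s) (fun h hh => idem_minor s (hid h hh))
        (fun h hh x => hsd h hh (x ∘ s)) hpos (by rwa [hgf])
      tauto
    · push Not at hbin
      obtain ⟨h, hh, s, hs⟩ := hbin
      have F2 := F.map_minor s
      have := admits_of_binary F2 (fun h hh => idem_minor s (hid h hh))
        (lt_of_le_of_ne (F2.nonneg_of_not_isProj hs) hh.symm) hs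
      tauto
  · rintro (h | h | h | h | h | h)
    · exact ⟨2, by norm_num, minOp, mem_polPlus_of_admitsMultimorphism h 0,
        by unfold Idem; decide, by unfold CyclicOp; decide⟩
    · exact ⟨2, by norm_num, maxOp, mem_polPlus_of_admitsMultimorphism h 0,
        by unfold Idem; decide, by unfold CyclicOp; decide⟩
    · exact ⟨2, by norm_num, minOp, mem_polPlus_of_admitsMultimorphism h 0,
        by unfold Idem; decide, by unfold CyclicOp; decide⟩
    · exact ⟨3, by norm_num, mjrtyOp, mem_polPlus_of_admitsMultimorphism h 0,
        by unfold Idem; decide, cyclicOp_mjrtyOp⟩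
    · exact ⟨3, by norm_num, mnrtyOp, mem_polPlus_of_admitsMultimorphism h 0,
        by unfold Idem; decide, cyclicOp_mnrtyOp⟩
    · exact ⟨3, by norm_num, mjrtyOp, mem_polPlus_of_admitsMultimorphism h 0,
        by unfold Idem; decide, cyclicOp_mjrtyOp⟩
end
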